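/- Let V and E be finite types, src, tgt : E → V, w : E → ℤ, and fix a source node s. Let P be a walk from s to a node t such that the weight of P is minimal among the weights of all walks from s to t, and the length of P is minimal among all walks from s to t attaining this minimal weight. Then the length of P is at most |V| − 1. -/

import Mathlib

namespace BFPaper

variable {V E : Type*}

/-- `IsWalk src tgt u v es` : the list of edges `es` forms a walk from `u` to `v`
in the directed multigraph given by source and target maps `src tgt : E → V`. -/
inductive IsWalk (src tgt : E → V) : V → V → List E → Prop
  | nil (u : V) : IsWalk src tgt u u []
  | cons {v : V} (e : E) {es : List E} (h : IsWalk src tgt (tgt e) v es) :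
      IsWalk src tgt (src e) v (e :: es)

/-- The weight of a walk: the sum of the weights of its edges. -/
def weight (w : E → ℤ) (es : List E) : ℤ := (es.map w).sum

/-- `v` is reachable from `s` if there is a walk from `s` to `v`. -/
def Reachable (src tgt : E → V) (s v : V) : Prop :=
  ∃ es : List E, IsWalk src tgt s v es

/-- There is a negative-weight cycle reachable from `s`. -/
def HasNegCycleFrom (src tgt : E → V) (w : E → ℤ) (s : V) : Prop :=
  ∃ (u : V) (es : List E), es ≠ [] ∧ IsWalk src tgt u u es ∧
    weight w es < 0 ∧ Reachable src tgt s u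

/-- The Bellman-Ford distance function `d : ℕ → V → WithTop ℤ`. -/
def bfDist [Fintype E] [DecidableEq V] (src tgt : E → V) (w : E → ℤ) (s : V) :
    ℕ → V → WithTop ℤ
  | 0 => fun v => if v = s then (0 : WithTop ℤ) else ⊤
  | (k+1) => fun v =>
      min (bfDist src tgt w s k v)
        (Finset.univ.inf fun e : E =>
          if tgt e = v then bfDist src tgt w s k (src e) + (w e : WithTop ℤ) else ⊤)

end BFPaper

namespace BFPaper

theorem weight_append {E : Type*} (w : E → ℤ) (a b : List E) :
    weight w (a ++ b) = weight w a + weight w b := by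
  simp [weight]

/-- The node reached from `u` after following the edges of `es`. -/
def endpoint {V E : Type*} (tgt : E → V) (u : V) (es : List E) : V :=
  es.foldl (fun _ e => tgt e) u

theorem endpoint_append {V E : Type*} (tgt : E → V) (u : V) (a b : List E) :
    endpoint tgt u (a ++ b) = endpoint tgt (endpoint tgt u a) b := by
  simp [endpoint]

namespace IsWalk

variable {V E : Type*} {src tgt : E → V}

theorem append {u x v : V} {a b : List E} (ha : IsWalk src tgt u x a)
    (hb : IsWalk src tgt x v b) : IsWalk src tgt u v (a ++ b) := by
  induction ha with
  | nil => exact hb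
  | cons e _ ih => exact .cons e (ih hb)

theorem split {u v : V} {a b : List E} (h : IsWalk src tgt u v (a ++ b)) :
    IsWalk src tgt u (endpoint tgt u a) a ∧ IsWalk src tgt (endpoint tgt u a) v b := by
  induction a generalizing u with
  | nil => exact ⟨.nil u, h⟩
  | cons e a ih =>
    cases h with
    | cons _ h => exact ⟨.cons e (ih h).1, (ih h).2⟩

/-- A walk with at least as many edges as there are nodes contains a nonempty closed walk. -/
theorem exists_cycle [Fintype V] {u v : V} {es : List E} (h : IsWalk src tgt u v es)
    (hlen : Fintype.card V ≤ es.length) :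
    ∃ (x : V) (a c b : List E), es = a ++ (c ++ b) ∧ c ≠ [] ∧ IsWalk src tgt u x a ∧
      IsWalk src tgt x x c ∧ IsWalk src tgt x v b := by
  obtain ⟨i, j, hij, hf⟩ : ∃ i j : Fin (es.length + 1), i < j ∧
      endpoint tgt u (es.take i) = endpoint tgt u (es.take j) := by
    obtain ⟨i, j, hne, hf⟩ := Fintype.exists_ne_map_eq_of_card_lt
      (fun i : Fin (es.length + 1) => endpoint tgt u (es.take i)) (by simpa using by omega)
    rcases lt_or_gt_of_ne hne with hij | hij
    · exact ⟨i, j, hij, hf⟩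
    · exact ⟨j, i, hij, hf.symm⟩
  have hij' : (i : ℕ) < j := hij
  have hj : es.take i ++ (es.drop i).take (j - i) = es.take j := by
    rw [← List.take_add, Nat.add_sub_cancel' hij'.le]
  have hes : es = es.take i ++ ((es.drop i).take (j - i) ++ (es.drop i).drop (j - i)) := by
    rw [List.take_append_drop, List.take_append_drop]
  have hc : endpoint tgt (endpoint tgt u (es.take i)) ((es.drop i).take (j - i)) =
      endpoint tgt u (es.take i) := by
    rw [← endpoint_append, hj, hf]
  rw [hes] at h
  obtain ⟨ha, hcb⟩ := h.split
  obtain ⟨hcw, hb⟩ := hcb.split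
  rw [hc] at hcw hb
  refine ⟨_, _, _, _, hes, ?_, ha, hcw, hb⟩
  apply List.ne_nil_of_length_pos
  rw [List.length_take, List.length_drop]
  omega

end IsWalk

end BFPaper

/-- A minimum-weight walk from `s` to `t` of minimal length among minimum-weight
walks has length at most `|V| - 1`. -/
theorem min_weight_min_length_walk_short
    (V E : Type*) [Fintype V] [Fintype E] (src tgt : E → V) (w : E → ℤ) (s t : V)
    (P : List E) (hP : BFPaper.IsWalk src tgt s t P)
    (hmin : ∀ Q : List E, BFPaper.IsWalk src tgt s t Q →
        BFPaper.weight w P ≤ BFPaper.weight w Q)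
    (hlen : ∀ Q : List E, BFPaper.IsWalk src tgt s t Q →
        BFPaper.weight w Q = BFPaper.weight w P → P.length ≤ Q.length) :
    P.length ≤ Fintype.card V - 1 := by
  by_contra hlong
  obtain ⟨x, a, c, b, rfl, hc, ha, hcw, hb⟩ := hP.exists_cycle (by omega)
  have hcpos : 0 < c.length := List.length_pos_of_ne_nil hc
  have hskip := hmin _ (ha.append hb)
  have htwice := hmin _ (ha.append (hcw.append (hcw.append hb)))
  have hshort := hlen _ (ha.append hb)
  simp only [BFPaper.weight_append, List.length_append] at hskip htwice hshort
  have := hshort (by omega)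
  omega
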